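/- For all nonnegative integers i and m, the symmetrization F~_i^m(x,y) + F~_i^m(y,x) lies in the ideal of ℚ[x,y] generated by (x+y+m)_{2m+1} = (x+y+m)(x+y+m−1)···(x+y−m). -/

import Mathlib

open MvPolynomial

/-- Falling factorial `(a)_k = a(a-1)⋯(a-k+1)`. -/
noncomputable def ff {R : Type*} [CommRing R] (a : R) (k : ℕ) : R :=
  ∏ j ∈ Finset.range k, (a - (j : R))

/-- `F2 i m = 2·F̃ᵢᵐ(x,y)` as a polynomial in `ℚ[x,y]`, with `x = X 0`, `y = X 1`. -/
noncomputable def F2 (i m : ℕ) : MvPolynomial (Fin 2) ℚ :=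
  ∑ u ∈ Finset.range (m+1),
    C ((m.choose u : ℚ) * (-1)^u * (m.factorial : ℚ) / ff ((m:ℚ) + i + u + 1/2) (m+1))
      * ff (X 0 + C ((m:ℚ) + i + u)) (2*m+2*i+2*u+1)
      * ff (X 1 + C ((m:ℚ) + i)) (m-u)
      * ff (X 1 - C ((i:ℚ) + u + 1)) (m-u)

/-- `F̃ᵢᵐ(x,y)` itself. -/
noncomputable def Ft (i m : ℕ) : MvPolynomial (Fin 2) ℚ := C (1/2 : ℚ) * F2 i m

/-- Rising factorial `a(a+1)⋯(a+k-1)`. -/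
noncomputable def rf {R : Type*} [CommRing R] (a : R) (k : ℕ) : R :=
  ∏ j ∈ Finset.range k, (a + (j : R))

section RisingFactorial

variable {R : Type*} [CommRing R]

@[simp] lemma rf_zero (a : R) : rf a 0 = 1 := by simp [rf]

lemma rf_succ (a : R) (k : ℕ) : rf a (k + 1) = rf a k * (a + k) := by
  simp [rf, Finset.prod_range_succ]

lemma rf_succ' (a : R) (k : ℕ) : rf a (k + 1) = a * rf (a + 1) k := by
  simp only [rf, Finset.prod_range_succ']
  rw [mul_comm]
  congr 1
  · simp
  · exact Finset.prod_congr rfl fun j _ => by push_cast; ring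

lemma rf_add (a : R) (k l : ℕ) : rf a (k + l) = rf a k * rf (a + k) l := by
  simp only [rf, Finset.prod_range_add]
  congr 1
  exact Finset.prod_congr rfl fun j _ => by push_cast; ring

lemma rf_neg (a : R) (k : ℕ) : rf (1 - a - k) k = (-1) ^ k * rf a k := by
  induction k with
  | zero => simp
  | succ k ih =>
    rw [rf_succ' (1 - a - _), rf_succ a, pow_succ]
    have h : (1 - a - ((k + 1 : ℕ) : R)) + 1 = 1 - a - k := by push_cast; ring
    rw [h, ih]
    push_cast
    ring

lemma map_rf {S : Type*} [CommRing S] (f : R →+* S) (a : R) (k : ℕ) :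
    f (rf a k) = rf (f a) k := by
  simp [rf, map_prod]

lemma ff_eq_rf (a : R) (k : ℕ) : ff a k = rf (a + 1 - k) k := by
  unfold ff rf
  rw [← Finset.prod_range_reflect]
  refine Finset.prod_congr rfl fun j hj => ?_
  have hj := Finset.mem_range.mp hj
  obtain ⟨l, rfl⟩ := Nat.exists_eq_add_of_lt hj
  have h : j + l + 1 - 1 - j = l := by omega
  rw [h]
  push_cast
  ring

lemma rf_add_one_sub (c : R) (k : ℕ) : rf (c + 1) (k + 1) - rf c (k + 1) = (k + 1) * rf (c + 1) k := by
  rw [rf_succ, rf_succ']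
  ring

/-- The left-hand side of the Pfaff–Saalschütz identity, cleared of denominators. -/
noncomputable def saalschutzSum (m : ℕ) (a b c : R) : R :=
  ∑ u ∈ Finset.range (m + 1),
    (m.choose u : R) * (rf a u * rf b u * rf (c + u) (m - u) * rf (c - a - b) (m - u))

lemma sum_choose_succ (m : ℕ) (f : ℕ → R) :
    ∑ u ∈ Finset.range (m + 2), ((m + 1).choose u : R) * f u =
      ∑ u ∈ Finset.range (m + 1), (m.choose u : R) * (f u + f (u + 1)) := by
  have h : ∑ u ∈ Finset.range (m + 1), (m.choose u : R) * f u =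
      ∑ u ∈ Finset.range (m + 1), (m.choose (u + 1) : R) * f (u + 1) + f 0 := by
    rw [Finset.sum_range_succ', Finset.sum_range_succ (fun u => (m.choose (u + 1) : R) * _)]
    simp
  rw [Finset.sum_range_succ']
  simp only [Nat.choose_succ_succ, Nat.cast_add, mul_add, add_mul, Finset.sum_add_distrib, h]
  simp
  ring

lemma saalschutzSum_shift (m : ℕ) (a b c : R) :
    ∑ u ∈ Finset.range (m + 2), ((m + 1).choose u : R) *
        (rf a u * rf b u * rf (c + u + 1) (m + 1 - u) * rf (c - a - b) (m + 1 - u)) =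
      saalschutzSum (m + 1) a b c +
        (m + 1) * (c - a - b) * saalschutzSum m a b (c + 1) := by
  rw [← sub_eq_iff_eq_add']
  unfold saalschutzSum
  rw [← Finset.sum_sub_distrib, Finset.sum_range_succ, Finset.mul_sum]
  simp only [Nat.sub_self, rf_zero, sub_self, add_zero]
  refine Finset.sum_congr rfl fun u hu => ?_
  obtain ⟨l, rfl⟩ := Nat.exists_eq_add_of_le (Nat.lt_succ_iff.mp (Finset.mem_range.mp hu))
  have h1 : u + l + 1 - u = l + 1 := by omega
  have h2 : u + l - u = l := by omega
  have hc : (((u + l + 1).choose u : ℕ) : R) * (l + 1) = ((u + l : ℕ) + 1) * ((u + l).choose u : ℕ) := by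
    have := Nat.choose_mul_succ_eq (u + l) u
    rw [h1] at this
    have := congrArg (Nat.cast : ℕ → R) this
    push_cast at this ⊢
    linear_combination -this
  have hd := rf_add_one_sub (c + u) l
  have he : c + 1 - a - b = c - a - b + 1 := by ring
  have hf : c + 1 + (u : R) = c + u + 1 := by ring
  rw [h1, h2, he, hf, rf_succ' (c - a - b)]
  linear_combination ((u + l + 1).choose u : R) * rf a u * rf b u * (c - a - b) *
    rf (c - a - b + 1) l * hd + rf a u * rf b u * (c - a - b) *
    rf (c - a - b + 1) l * rf (c + u + 1) l * hc

lemma saalschutzSum_succ (m : ℕ) (a b c : R) :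
    saalschutzSum (m + 1) a b c = m * (c + m) * saalschutzSum m a b c +
      (c - a) * (c - b) * ∑ u ∈ Finset.range (m + 1), (m.choose u : R) *
        (rf a u * rf b u * rf (c + u + 1) (m - u) * rf (c - a - b) (m - u)) := by
  unfold saalschutzSum
  rw [sum_choose_succ, Finset.mul_sum, Finset.mul_sum, ← Finset.sum_add_distrib]
  refine Finset.sum_congr rfl fun u hu => ?_
  obtain ⟨l, rfl⟩ := Nat.exists_eq_add_of_le (Nat.lt_succ_iff.mp (Finset.mem_range.mp hu))
  have h1 : u + l + 1 - u = l + 1 := by omega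
  have h2 : u + l - u = l := by omega
  have h3 : u + l + 1 - (u + 1) = l := by omega
  have hd : (c + u) * rf (c + u + 1) l = rf (c + u) l * (c + u + l) := by
    rw [← rf_succ, rf_succ']
  have hf : c + ((u + 1 : ℕ) : R) = c + u + 1 := by push_cast; ring
  rw [h1, h2, h3, hf, rf_succ' (c + u), rf_succ (c - a - b), rf_succ a, rf_succ b]
  push_cast
  linear_combination ((u + l).choose u : R) * rf a u * rf b u * rf (c - a - b) l * (u + l) * hd

/-- The Pfaff–Saalschütz identity. -/
theorem saalschutzSum_eq (m : ℕ) (a b c : R) :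
    saalschutzSum m a b c = rf (c - a) m * rf (c - b) m := by
  induction m using Nat.twoStepInduction generalizing c with
  | zero => simp [saalschutzSum]
  | one => simp [saalschutzSum, Finset.sum_range_succ, rf_succ]; ring
  | more m ih ih' =>
    have h1 : c + 1 - a = c - a + 1 := by ring
    have h2 : c + 1 - b = c - b + 1 := by ring
    rw [saalschutzSum_succ, saalschutzSum_shift, ih' c, ih (c + 1), h1, h2,
      rf_succ (c - a) (m + 1), rf_succ (c - b) (m + 1), rf_succ' (c - a) m, rf_succ' (c - b) m]
    push_cast
    ring

/-- The product `∏_{|j| ≤ N} (x + j)`. -/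
noncomputable def oddBlock (N : ℕ) (x : R) : R := rf (x - N) (2 * N + 1)

/-- The product `∏_{n < j ≤ n + l} (y² - j²)`. -/
noncomputable def evenBlock (n l : ℕ) (y : R) : R := rf (y + n + 1) l * rf (y - n - l) l

lemma oddBlock_succ (N : ℕ) (x : R) :
    oddBlock (N + 1) x = (x ^ 2 - (N + 1) ^ 2) * oddBlock N x := by
  unfold oddBlock
  have h : 2 * (N + 1) + 1 = 2 * N + 1 + 1 + 1 := by ring
  have h' : x - ((N + 1 : ℕ) : R) + 1 = x - N := by push_cast; ring
  rw [h, rf_succ', rf_succ, h']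
  push_cast
  ring

lemma oddBlock_neg (N : ℕ) (x : R) : oddBlock N (-x) = -oddBlock N x := by
  unfold oddBlock
  have h := rf_neg (x - N) (2 * N + 1)
  rw [show 1 - (x - N) - ((2 * N + 1 : ℕ) : R) = -x - N by push_cast; ring] at h
  rw [h, Odd.neg_one_pow ⟨N, rfl⟩]
  ring

lemma evenBlock_zero (n : ℕ) (y : R) : evenBlock n 0 y = 1 := by simp [evenBlock]

lemma evenBlock_succ_left (n l : ℕ) (y : R) :
    evenBlock n (l + 1) y = (y ^ 2 - (n + 1) ^ 2) * evenBlock (n + 1) l y := by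
  unfold evenBlock
  have h : y - n - ((l + 1 : ℕ) : R) = y - ((n + 1 : ℕ) : R) - l := by push_cast; ring
  have h' : y + n + 1 + 1 = y + ((n + 1 : ℕ) : R) + 1 := by push_cast; ring
  rw [rf_succ', rf_succ, h, h']
  push_cast
  ring

lemma evenBlock_succ_right (n l : ℕ) (y : R) :
    evenBlock n (l + 1) y = (y ^ 2 - (n + l + 1) ^ 2) * evenBlock n l y := by
  unfold evenBlock
  have h : y - n - ((l + 1 : ℕ) : R) + 1 = y - n - l := by push_cast; ring
  rw [rf_succ, rf_succ', h]
  push_cast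
  ring

lemma evenBlock_neg (n l : ℕ) (y : R) : evenBlock n l (-y) = evenBlock n l y := by
  induction l with
  | zero => simp [evenBlock_zero]
  | succ l ih => rw [evenBlock_succ_right, evenBlock_succ_right, ih, neg_sq]

lemma ff_mul_ff_eq_oddBlock_mul_evenBlock (i u l : ℕ) (x y : R) :
    ff (x + ((u + l : ℕ) + i + u)) (2 * (u + l) + 2 * i + 2 * u + 1) *
        (ff (y + ((u + l : ℕ) + i)) l * ff (y - (i + u + 1)) l) =
      oddBlock (u + l + i + u) x * evenBlock (i + u) l y := by
  have h1 : x + ((u + l : ℕ) + i + u) + 1 - ((2 * (u + l) + 2 * i + 2 * u + 1 : ℕ) : R) =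
      x - (u + l + i + u : ℕ) := by
    push_cast; ring
  have h2 : y + ((u + l : ℕ) + i) + 1 - (l : R) = y + (i + u : ℕ) + 1 := by push_cast; ring
  have h3 : y - (i + u + 1) + 1 - (l : R) = y - (i + u : ℕ) - l := by push_cast; ring
  have h4 : 2 * (u + l) + 2 * i + 2 * u + 1 = 2 * (u + l + i + u) + 1 := by ring
  rw [ff_eq_rf, ff_eq_rf, ff_eq_rf, h1, h2, h3, h4, oddBlock, evenBlock]

end RisingFactorial

/-- The rational coefficient of the `u`-th summand of `F2 i m`. -/
noncomputable def coef (i m u : ℕ) : ℚ :=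
  (m.choose u : ℚ) * (-1) ^ u * (m.factorial : ℚ) / rf ((i : ℚ) + u + 1 / 2) (m + 1)

lemma rf_pos {a : ℚ} (ha : 0 < a) (k : ℕ) : 0 < rf a k :=
  Finset.prod_pos fun _ _ => by positivity

lemma coef_succ_eq (i n u : ℕ) (hu : u ≤ n) :
    (u + 1) * coef (i + 1) n (u + 1) = -((n - u) * coef (i + 2) n u) := by
  have hc : ((n.choose (u + 1) : ℕ) : ℚ) * (u + 1) = n.choose u * (n - u) := by
    have := congrArg (Nat.cast : ℕ → ℚ) (Nat.choose_succ_right_eq n u)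
    push_cast [Nat.cast_sub hu] at this
    exact this
  unfold coef
  rw [show ((i + 1 : ℕ) : ℚ) + (u + 1 : ℕ) + 1 / 2 = (i + 2 : ℕ) + u + 1 / 2 by push_cast; ring]
  rw [pow_succ, mul_div_assoc', mul_div_assoc', ← neg_div]
  congr 1
  linear_combination -(-1) ^ u * (n.factorial : ℚ) * hc

lemma coef_rec_zero (i n : ℕ) :
    (2 * i + 1 : ℚ) / (2 * (n + 1)) * coef i (n + 1) 0 = coef (i + 1) n 0 := by
  unfold coef
  have h : (i : ℚ) + 1 / 2 + 1 = (i + 1 : ℕ) + 1 / 2 := by push_cast; ring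
  have hp := (rf_pos (by positivity : 0 < (((i + 1 : ℕ) : ℚ) + 1 / 2)) (n + 1)).ne'
  rw [Nat.cast_zero, add_zero, add_zero, rf_succ' _ (n + 1), h, Nat.factorial_succ]
  push_cast at hp ⊢
  field_simp
  simp

lemma coef_rec_succ (i n u : ℕ) :
    (2 * i + 1 : ℚ) / (2 * (n + 1)) * coef i (n + 1) (u + 1) =
      coef (i + 1) n (u + 1) + coef (i + 1) n u - 2 * coef (i + 2) n u := by
  have hc : ((n + 1).choose (u + 1) : ℚ) * (u + 1) = (n + 1) * n.choose u := by
    exact_mod_cast (Nat.add_one_mul_choose_eq n u).symm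
  have hc' : ((n + 1).choose (u + 1) : ℚ) = n.choose u + n.choose (u + 1) := by
    exact_mod_cast Nat.choose_succ_succ n u
  unfold coef
  set a : ℚ := (i : ℚ) + u + 3 / 2 with ha
  have ha0 : 0 < a := by positivity
  rw [show (i : ℚ) + (u + 1 : ℕ) + 1 / 2 = a by push_cast; ring,
    show ((i + 1 : ℕ) : ℚ) + (u + 1 : ℕ) + 1 / 2 = a + 1 by push_cast; ring,
    show ((i + 1 : ℕ) : ℚ) + u + 1 / 2 = a by push_cast; ring,
    show ((i + 2 : ℕ) : ℚ) + u + 1 / 2 = a + 1 by push_cast; ring]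
  have hi : (i : ℚ) = a - u - 3 / 2 := by rw [ha]; ring
  have h1 : rf a (n + 1 + 1) = rf a (n + 1) * (a + (n + 1)) := by rw [rf_succ]; push_cast; ring
  have h2 : a * rf (a + 1) (n + 1) = rf a (n + 1) * (a + (n + 1)) := by
    rw [← rf_succ', h1]
  have hp := (rf_pos ha0 (n + 1)).ne'
  have h3 : rf (a + 1) (n + 1) = rf a (n + 1) * (a + (n + 1)) / a := by
    field_simp; linear_combination h2
  have hq : a + (n + 1) ≠ 0 := by positivity
  rw [h1, h3, Nat.factorial_succ, hi]
  push_cast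
  rw [hc'] at hc ⊢
  field_simp
  rw [pow_succ]
  linear_combination 2 * (-1) ^ u * hc

section Algebra

variable {R : Type*} [CommRing R] [Algebra ℚ R]

/-- The polynomial `F2 i m` evaluated in a commutative `ℚ`-algebra. -/
noncomputable def evalF (i m : ℕ) (x y : R) : R :=
  ∑ u ∈ Finset.range (m + 1), algebraMap ℚ R (coef i m u) *
    (oddBlock (m + i + u) x * evenBlock (i + u) (m - u) y)

lemma map_evalF {S : Type*} [CommRing S] [Algebra ℚ S] (f : R →ₐ[ℚ] S) (i m : ℕ) (x y : R) :
    f (evalF i m x y) = evalF i m (f x) (f y) := by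
  have h (a : R) (k : ℕ) : f (rf a k) = rf (f a) k := map_rf (f : R →+* S) a k
  simp [evalF, oddBlock, evenBlock, h]

lemma evalF_neg (i m : ℕ) (x y : R) : evalF i m (-x) (-y) = -evalF i m x y := by
  simp [evalF, oddBlock_neg, evenBlock_neg]

lemma evalF_rec (i n : ℕ) (x y : R) :
    algebraMap ℚ R ((2 * i + 1) / (2 * (n + 1))) * evalF i (n + 1) x y =
      (x ^ 2 + y ^ 2 - (i + n + 2) ^ 2 - (i + 1) ^ 2) * evalF (i + 1) n x y
        - 2 * evalF (i + 2) n x y := by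
  let T : ℕ → R := fun v => oddBlock (n + 1 + i + v) x * evenBlock (i + v) (n + 1 - v) y
  let c₁ : ℕ → R := fun v => algebraMap ℚ R (coef (i + 1) n v)
  let c₂ : ℕ → R := fun v => algebraMap ℚ R (coef (i + 2) n v)
  have hc₁ : c₁ (n + 1) = 0 := by simp [c₁, coef]
  let g : ℕ → R := fun u => c₁ u * (2 * u * (2 * i + n + u + 3)) *
    (oddBlock (n + 1 + i + u) x * evenBlock (i + 1 + u) (n - u) y)
  have hg : ∑ u ∈ Finset.range (n + 1), (g (u + 1) - g u) = 0 := by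
    rw [Finset.sum_range_sub]
    simp [g, hc₁]
  have hl : algebraMap ℚ R ((2 * i + 1) / (2 * (n + 1))) * evalF i (n + 1) x y =
      ∑ u ∈ Finset.range (n + 1), (c₁ u * T u + (c₁ u - 2 * c₂ u) * T (u + 1)) := by
    have h0 : ∑ v ∈ Finset.range (n + 1), c₁ v * T v =
        ∑ v ∈ Finset.range (n + 1), c₁ (v + 1) * T (v + 1) + c₁ 0 * T 0 := by
      rw [← Finset.sum_range_succ' (fun v => c₁ v * T v), Finset.sum_range_succ _ (n + 1), hc₁]
      ring
    rw [Finset.sum_add_distrib, h0, add_right_comm, ← Finset.sum_add_distrib, evalF,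
      Finset.mul_sum, Finset.sum_range_succ']
    simp only [← mul_assoc (algebraMap ℚ R _) (algebraMap ℚ R _), ← map_mul, coef_rec_succ,
      coef_rec_zero]
    congr 1
    refine Finset.sum_congr rfl fun u _ => ?_
    simp only [map_add, map_sub, map_mul, map_ofNat, c₁, c₂, T]
    ring
  rw [hl, ← sub_eq_zero, ← hg, eq_comm, ← sub_eq_zero]
  unfold evalF
  rw [Finset.mul_sum, Finset.mul_sum, ← Finset.sum_sub_distrib, ← Finset.sum_sub_distrib,
    ← Finset.sum_sub_distrib]
  refine Finset.sum_eq_zero fun u hu => ?_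
  obtain ⟨l, rfl⟩ := Nat.exists_eq_add_of_le (Nat.lt_succ_iff.mp (Finset.mem_range.mp hu))
  have hT : T u = (y ^ 2 - (i + u + 1) ^ 2) *
      (oddBlock (u + l + 1 + i + u) x * evenBlock (i + 1 + u) l y) := by
    simp only [T]
    rw [show u + l + 1 - u = l + 1 by omega, evenBlock_succ_left,
      show i + u + 1 = i + 1 + u by omega]
    push_cast
    ring
  have hO : oddBlock (u + l + 1 + i + (u + 1)) x =
      (x ^ 2 - (u + l + i + u + 2) ^ 2) * oddBlock (u + l + 1 + i + u) x := by
    rw [← add_assoc _ u 1, oddBlock_succ]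
    push_cast
    ring
  have hT' : T (u + 1) = oddBlock (u + l + 1 + i + (u + 1)) x * evenBlock (i + 1 + u) l y := by
    simp only [T]
    rw [show u + l + 1 - (u + 1) = l by omega, show i + (u + 1) = i + 1 + u by omega]
  have hg' : g (u + 1) = 2 * c₂ u * oddBlock (u + l + 1 + i + (u + 1)) x *
      (evenBlock (i + 2 + u) l y - evenBlock (i + 1 + u) l y) := by
    have hc := congrArg (algebraMap ℚ R) (coef_succ_eq i (u + l) u (by omega))
    simp only [map_mul, map_neg, map_add, map_sub, map_one, map_natCast, Nat.cast_add] at hc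
    simp only [g, c₁, c₂]
    cases l with
    | zero =>
      simp only [evenBlock_zero, Nat.cast_zero] at hc ⊢
      rw [Nat.sub_eq_zero_of_le (by omega), evenBlock_zero]
      push_cast
      linear_combination 2 * (2 * i + u + (u + 1) + 3) *
        oddBlock (u + 0 + 1 + i + (u + 1)) x * hc
    | succ l =>
      rw [show u + (l + 1) - (u + 1) = l by omega, evenBlock_succ_left (i + 1 + u),
        evenBlock_succ_right (i + 2 + u), show i + 1 + (u + 1) = i + 2 + u by omega,
        show i + 1 + u + 1 = i + 2 + u by omega]
      push_cast at hc ⊢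
      linear_combination 2 * (2 * i + (u + l + 1) + (u + 1) + 3) *
        oddBlock (u + (l + 1) + 1 + i + (u + 1)) x * evenBlock (i + 2 + u) l y * hc
  rw [hg', hT, hT', hO]
  simp only [g, c₁, c₂]
  rw [show u + l + (i + 1) + u = u + l + 1 + i + u by omega,
    show u + l + (i + 2) + u = u + l + 1 + i + (u + 1) by omega, hO,
    show u + l - u = l by omega]
  push_cast
  ring

/-- The common value of the two sums compared in `evalF_add_evalF_swap_eq_zero`. -/
lemma sum_coef_mul_rf (i m : ℕ) (x : R) :
    ∑ u ∈ Finset.range (m + 1), algebraMap ℚ R (coef i m u) *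
        ((-1) ^ u * (rf (m + i + 1 - x) u * rf (x - i) (m - u))) =
      algebraMap ℚ R (m.factorial * rf ((m : ℚ) + 1) m / rf ((i : ℚ) + 1 / 2) (2 * m + 1)) *
        rf (x + algebraMap ℚ R (1 / 2)) m := by
  set a : ℚ := i + 1 / 2 with ha
  set h : R := algebraMap ℚ R (1 / 2) with hh
  have haR : algebraMap ℚ R a = i + h := by simp [ha, hh]
  have hs := saalschutzSum_eq m (algebraMap ℚ R a) (m + i + 1 - x) (algebraMap ℚ R (a + m + 1))
  have e1 : algebraMap ℚ R (a + m + 1) - algebraMap ℚ R a - (m + i + 1 - x) = x - i := by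
    simp; ring
  have e2 : algebraMap ℚ R (a + m + 1) - algebraMap ℚ R a = algebraMap ℚ R ((m : ℚ) + 1) := by
    simp; ring
  have e3 : algebraMap ℚ R (a + m + 1) - (m + i + 1 - x) = x + h := by
    simp only [map_add, haR, map_natCast, map_one]; ring
  unfold saalschutzSum at hs
  rw [e1, e2, e3, ← map_rf] at hs
  rw [mul_div_right_comm, map_mul, mul_assoc, ← hs, Finset.mul_sum]
  refine Finset.sum_congr rfl fun u hu => ?_
  have hum := Nat.lt_succ_iff.mp (Finset.mem_range.mp hu)
  have hcoef : coef i m u * (-1) ^ u =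
      m.factorial / rf a (2 * m + 1) * (m.choose u * rf a u * rf (a + m + 1 + u) (m - u)) := by
    obtain ⟨l, rfl⟩ := Nat.exists_eq_add_of_le hum
    have ha0 : 0 < a := by positivity
    have hsplit : rf a (2 * (u + l) + 1) =
        rf a u * rf (a + u) (u + l + 1) * rf (a + (u + l : ℕ) + 1 + u) l := by
      rw [show 2 * (u + l) + 1 = u + (u + l + 1) + l by ring, rf_add, rf_add]
      congr 2
      push_cast
      ring
    have p1 := (rf_pos ha0 u).ne'
    have p2 := (rf_pos (by positivity : 0 < a + u) (u + l + 1)).ne'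
    have p3 := (rf_pos (by positivity : 0 < a + (u + l : ℕ) + 1 + u) l).ne'
    rw [hsplit, coef, show (i : ℚ) + u + 1 / 2 = a + u by rw [ha]; ring,
      show u + l - u = l by omega]
    field_simp
    rw [← pow_mul, mul_comm u 2, pow_mul]
    simp
  have hcoef := congrArg (algebraMap ℚ R) hcoef
  simp only [map_mul, map_rf, map_pow, map_neg, map_one, map_natCast, map_add] at hcoef ⊢
  linear_combination rf (m + i + 1 - x) u * rf (x - i) (m - u) * hcoef

lemma evalF_add_evalF_swap_eq_zero (i m : ℕ) (x y : R) (hxy : x + y + m = 0) :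
    evalF i m x y + evalF i m y x = 0 := by
  obtain rfl : y = -(x + m) := by linear_combination hxy
  set K : R := rf (x - m - i) (3 * m + 2 * i + 1) with hK
  have h1 : evalF i m x (-(x + m)) = K * ∑ u ∈ Finset.range (m + 1),
      algebraMap ℚ R (coef i m u) *
        ((-1) ^ u * (rf (m + i + 1 - x) u * rf (x - i) (m - u))) := by
    unfold evalF
    rw [Finset.mul_sum]
    refine Finset.sum_congr rfl fun u hu => ?_
    obtain ⟨l, rfl⟩ := Nat.exists_eq_add_of_le (Nat.lt_succ_iff.mp (Finset.mem_range.mp hu))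
    have hr := rf_neg ((u + l : ℕ) + i + 1 - x) u
    rw [show 1 - ((u + l : ℕ) + i + 1 - x) - (u : R) = x - (u + l + i + u : ℕ) by
      push_cast; ring] at hr
    have hA := rf_add (x - (u + l + i + u : ℕ)) (2 * (u + l + i + u) + 1) l
    rw [show 2 * (u + l + i + u) + 1 + l = u + (3 * (u + l) + 2 * i + 1) by ring, rf_add, hr,
      show x - (u + l + i + u : ℕ) + (u : R) = x - (u + l : ℕ) - i by push_cast; ring, ← hK] at hA
    rw [evenBlock_neg, oddBlock, evenBlock, show u + l - u = l by omega,
      show x + (u + l : ℕ) - ((i + u : ℕ) : R) - l = x - i by push_cast; ring,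
      show x + (u + l : ℕ) + ((i + u : ℕ) : R) + 1 =
        x - (u + l + i + u : ℕ) + ((2 * (u + l + i + u) + 1 : ℕ) : R) by push_cast; ring]
    linear_combination -algebraMap ℚ R (coef i (u + l) u) * rf (x - i) l * hA
  have h2 : evalF i m (-(x + m)) x = -(K * ((-1) ^ m * ∑ u ∈ Finset.range (m + 1),
      algebraMap ℚ R (coef i m u) *
        ((-1) ^ u * (rf (m + i + 1 - -(x + m)) u * rf (-(x + m) - i) (m - u))))) := by
    unfold evalF
    rw [Finset.mul_sum, Finset.mul_sum, ← Finset.sum_neg_distrib]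
    refine Finset.sum_congr rfl fun u hu => ?_
    obtain ⟨l, rfl⟩ := Nat.exists_eq_add_of_le (Nat.lt_succ_iff.mp (Finset.mem_range.mp hu))
    have hr := rf_neg (x + (i + u : ℕ) + 1) l
    rw [show 1 - (x + ((i + u : ℕ) : R) + 1) - (l : R) = -(x + (u + l : ℕ)) - i by
      push_cast; ring] at hr
    have hA := rf_add (x - (u + l : ℕ) - i) l (2 * (u + l + i + u) + 1)
    rw [show l + (2 * (u + l + i + u) + 1) = 3 * (u + l) + 2 * i + 1 + u by ring, rf_add, ← hK,
      show x - (u + l : ℕ) - i + (l : R) = x + (u + l : ℕ) - (u + l + i + u : ℕ) by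
        push_cast; ring,
      show x - (u + l : ℕ) - i + ((3 * (u + l) + 2 * i + 1 : ℕ) : R) =
        (u + l : ℕ) + i + 1 - -(x + (u + l : ℕ)) by push_cast; ring] at hA
    have hs : ((-1 : R) ^ (u + l) * (-1) ^ u) * (-1) ^ l = 1 := by
      rw [mul_assoc, ← pow_add, ← mul_pow]; simp
    rw [oddBlock_neg, oddBlock, evenBlock, show u + l - u = l by omega, hr,
      show x - ((i + u : ℕ) : R) - l = x - (u + l : ℕ) - i by push_cast; ring]
    linear_combination algebraMap ℚ R (coef i (u + l) u) * rf (x + (i + u : ℕ) + 1) l * hA +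
      algebraMap ℚ R (coef i (u + l) u) * rf (x + (i + u : ℕ) + 1) l * K *
        rf ((u + l : ℕ) + i + 1 - -(x + (u + l : ℕ))) u * hs
  have hr := rf_neg (x + algebraMap ℚ R (1 / 2)) m
  have hh : algebraMap ℚ R (1 / 2) + algebraMap ℚ R (1 / 2) = 1 := by rw [← map_add]; norm_num
  rw [show 1 - (x + algebraMap ℚ R (1 / 2)) - (m : R) = -(x + m) + algebraMap ℚ R (1 / 2) by
    linear_combination -hh] at hr
  have hs : (-1 : R) ^ m * (-1) ^ m = 1 := by rw [← mul_pow]; simp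
  rw [h1, h2, sum_coef_mul_rf, sum_coef_mul_rf, hr]
  set k := algebraMap ℚ R (m.factorial * rf ((m : ℚ) + 1) m / rf ((i : ℚ) + 1 / 2) (2 * m + 1))
  linear_combination -K * k * rf (x + algebraMap ℚ R (1 / 2)) m * hs

lemma add_dvd_evalF_add_evalF_swap (i m : ℕ) (x y : R) :
    x + y + m ∣ evalF i m x y + evalF i m y x := by
  rw [← Ideal.mem_span_singleton, ← Ideal.Quotient.eq_zero_iff_mem]
  let f := Ideal.Quotient.mkₐ ℚ (Ideal.span {x + y + (m : R)})
  have h : f (x + y + m) = 0 :=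
    Ideal.Quotient.eq_zero_iff_mem.mpr (Ideal.mem_span_singleton_self _)
  change f _ = 0
  rw [map_add, map_evalF, map_evalF]
  exact evalF_add_evalF_swap_eq_zero i m _ _ (by simpa using h)

lemma sub_dvd_evalF_add_evalF_swap (i m : ℕ) (x y : R) :
    x + y - m ∣ evalF i m x y + evalF i m y x := by
  have h := add_dvd_evalF_add_evalF_swap i m (-x) (-y)
  rw [evalF_neg, evalF_neg, ← neg_add (evalF _ _ _ _), dvd_neg, ← neg_dvd] at h
  convert h using 1
  ring

lemma isCoprime_of_sub_eq_algebraMap {a b : R} {q : ℚ} (hq : q ≠ 0)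
    (h : a - b = algebraMap ℚ R q) : IsCoprime a b := by
  refine ⟨algebraMap ℚ R q⁻¹, -algebraMap ℚ R q⁻¹, ?_⟩
  rw [neg_mul, ← sub_eq_add_neg, ← mul_sub, h, ← map_mul, inv_mul_cancel₀ hq, map_one]

theorem oddBlock_dvd_evalF_add_evalF_swap (i m : ℕ) (x y : R) :
    oddBlock m (x + y) ∣ evalF i m x y + evalF i m y x := by
  induction m generalizing i with
  | zero => simpa [oddBlock, rf_succ] using add_dvd_evalF_add_evalF_swap i 0 x y
  | succ m ih =>
    have h1 := add_dvd_evalF_add_evalF_swap i (m + 1) x y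
    have h2 := sub_dvd_evalF_add_evalF_swap i (m + 1) x y
    have h3 : oddBlock m (x + y) ∣ evalF i (m + 1) x y + evalF i (m + 1) y x := by
      have hq : ((2 * i + 1 : ℚ) / (2 * (m + 1))) ≠ 0 := by positivity
      have hu := (IsUnit.mk0 _ hq).map (algebraMap ℚ R)
      rw [← hu.dvd_mul_left, mul_add, evalF_rec, evalF_rec]
      convert dvd_sub
        ((ih (i + 1)).mul_left (x ^ 2 + y ^ 2 - (i + m + 2) ^ 2 - (i + 1) ^ 2))
        ((ih (i + 2)).mul_left 2) using 1
      ring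
    have c12 : IsCoprime (x + y + (m + 1 : ℕ)) (x + y - (m + 1 : ℕ)) :=
      isCoprime_of_sub_eq_algebraMap (q := 2 * (m + 1)) (by positivity) (by simp [map_ofNat]; ring)
    have c3 : IsCoprime ((x + y + (m + 1 : ℕ)) * (x + y - (m + 1 : ℕ))) (oddBlock m (x + y)) := by
      unfold oddBlock rf
      refine IsCoprime.prod_right fun j hj => ?_
      have hj : (j : ℚ) < 2 * m + 1 := by exact_mod_cast Finset.mem_range.mp hj
      have hj0 : (0 : ℚ) ≤ j := j.cast_nonneg
      refine IsCoprime.mul_left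
        (isCoprime_of_sub_eq_algebraMap (q := 2 * m + 1 - j) (by linarith) ?_)
        (isCoprime_of_sub_eq_algebraMap (q := -(j + 1)) (by linarith) ?_) <;>
      · simp [map_ofNat]
        ring
    have h := c3.mul_dvd (c12.mul_dvd h1 h2) h3
    rw [oddBlock_succ]
    convert h using 1
    push_cast
    ring

end Algebra

lemma F2_eq_evalF (i m : ℕ) : F2 i m = evalF i m (X 0) (X 1) := by
  unfold F2 evalF
  refine Finset.sum_congr rfl fun u hu => ?_
  obtain ⟨l, rfl⟩ := Nat.exists_eq_add_of_le (Nat.lt_succ_iff.mp (Finset.mem_range.mp hu))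
  have h1 : ((u + l : ℕ) : ℚ) + i + u + 1 / 2 + 1 - (u + l + 1 : ℕ) = i + u + 1 / 2 := by
    push_cast; ring
  simp only [map_add, map_natCast, map_one, Nat.add_sub_cancel_left]
  rw [ff_eq_rf (_ + 1 / 2), h1, algebraMap_eq, coef, mul_assoc, mul_assoc,
    ff_mul_ff_eq_oddBlock_mul_evenBlock]

theorem stmt10 (i m : ℕ) :
    Ft i m + rename (Equiv.swap (0 : Fin 2) 1) (Ft i m) ∈
      Ideal.span {ff (X 0 + X 1 + C (m:ℚ)) (2*m+1)} := by
  have h := oddBlock_dvd_evalF_add_evalF_swap i m (X 0 : MvPolynomial (Fin 2) ℚ) (X 1)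
  rw [Ideal.mem_span_singleton, ff_eq_rf, map_natCast]
  unfold Ft
  rw [map_mul, rename_C, F2_eq_evalF, map_evalF, rename_X, rename_X, Equiv.swap_apply_left,
    Equiv.swap_apply_right, ← mul_add]
  convert h.mul_left _ using 1
  unfold oddBlock
  congr 1
  push_cast
  ring
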